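/- Let R₁ and R₂ be rings and Γ = R₁ × R₂ their product ring. A left Γ-module M, decomposed as M = M₁ ⊕ M₂ with M₁ a left R₁-module and M₂ a left R₂-module, is Gorenstein projective over Γ if and only if M₁ is Gorenstein projective over R₁ and M₂ is Gorenstein projective over R₂. -/

import Mathlib

/-!
Common definitions: Gorenstein projective/flat modules, Ext-vanishing via projective
resolutions, Gorenstein projective dimension, flat and cotorsion modules over an
arbitrary (possibly noncommutative) ring, tensor product of a right module with a
left module, coherence and perfectness conditions.
-/

universe u v

noncomputable section

open Function

namespace GorensteinPrecover

section Tensor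

variable (R : Type u) [Ring R]

/-- The subgroup of `I ⊗ₗ[ℤ] F` by which one quotients to obtain the tensor product
`I ⊗[R] F` of a right `R`-module `I` with a left `R`-module `F`. -/
def tensorRel (I : Type v) [AddCommGroup I] [Module Rᵐᵒᵖ I]
    (F : Type v) [AddCommGroup F] [Module R F] :
    AddSubgroup (TensorProduct ℤ I F) :=
  AddSubgroup.closure
    {z | ∃ (r : R) (x : I) (y : F),
      z = (MulOpposite.op r • x) ⊗ₜ[ℤ] y - x ⊗ₜ[ℤ] (r • y)}

/-- The tensor product `I ⊗[R] F` (an abelian group) of a right `R`-module `I` with a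
left `R`-module `F` over a possibly noncommutative ring `R`. -/
def RTensor (I : Type v) [AddCommGroup I] [Module Rᵐᵒᵖ I]
    (F : Type v) [AddCommGroup F] [Module R F] : Type v :=
  TensorProduct ℤ I F ⧸ tensorRel R I F

instance (I : Type v) [AddCommGroup I] [Module Rᵐᵒᵖ I]
    (F : Type v) [AddCommGroup F] [Module R F] : AddCommGroup (RTensor R I F) :=
  QuotientAddGroup.Quotient.addCommGroup _

/-- Functoriality of `I ⊗[R] -` in the left module variable. -/
def rtMap (I : Type v) [AddCommGroup I] [Module Rᵐᵒᵖ I]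
    {F F' : Type v} [AddCommGroup F] [Module R F] [AddCommGroup F'] [Module R F']
    (g : F →ₗ[R] F') : RTensor R I F →+ RTensor R I F' :=
  QuotientAddGroup.map _ _
    (TensorProduct.map (LinearMap.id) (g.toAddMonoidHom.toIntLinearMap)).toAddMonoidHom
    (by
      refine (AddSubgroup.closure_le _).2 ?_
      rintro _ ⟨r, x, y, rfl⟩
      refine AddSubgroup.mem_comap.2 (AddSubgroup.subset_closure ⟨r, x, g y, ?_⟩)
      simp [TensorProduct.map_tmul, map_smul])

/-- Functoriality of `- ⊗[R] F` in the right module variable. -/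
def rtMapRight {I I' : Type v} [AddCommGroup I] [Module Rᵐᵒᵖ I]
    [AddCommGroup I'] [Module Rᵐᵒᵖ I']
    (F : Type v) [AddCommGroup F] [Module R F]
    (f : I →ₗ[Rᵐᵒᵖ] I') : RTensor R I F →+ RTensor R I' F :=
  QuotientAddGroup.map _ _
    (TensorProduct.map (f.toAddMonoidHom.toIntLinearMap) (LinearMap.id)).toAddMonoidHom
    (by
      refine (AddSubgroup.closure_le _).2 ?_
      rintro _ ⟨r, x, y, rfl⟩
      refine AddSubgroup.mem_comap.2 (AddSubgroup.subset_closure ⟨r, f x, y, ?_⟩)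
      simp [TensorProduct.map_tmul, map_smul])

end Tensor

section Defs

variable (R : Type u) [Ring R]

/-- A left `R`-module `M` is *Gorenstein projective* if there is an exact complex of
projective modules `⋯ → P₁ → P₀ → P₋₁ → ⋯` which stays exact after applying
`Hom(-, Q)` for every projective module `Q`, with `M ≅ ker (P₀ → P₋₁)`. -/
def IsGorensteinProjective (M : ModuleCat.{v} R) : Prop :=
  ∃ (P : ℤ → ModuleCat.{v} R) (d : ∀ i : ℤ, P (i + 1) →ₗ[R] P i),
    (∀ i, Module.Projective R (P i)) ∧
    (∀ i, Function.Exact (d (i + 1)) (d i)) ∧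
    (∀ Q : ModuleCat.{v} R, Module.Projective R Q →
      ∀ i : ℤ, Function.Exact
        (fun f : P i →ₗ[R] Q => f.comp (d i))
        (fun f : P (i + 1) →ₗ[R] Q => f.comp (d (i + 1)))) ∧
    Nonempty (M ≃ₗ[R] LinearMap.ker (d (-1)))

/-- A left `R`-module `M` is *flat* if tensoring with it preserves injectivity of maps
of right `R`-modules. -/
def IsFlatMod (M : ModuleCat.{v} R) : Prop :=
  ∀ (I I' : ModuleCat.{v} Rᵐᵒᵖ) (f : I →ₗ[Rᵐᵒᵖ] I'), Function.Injective f →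
    Function.Injective (rtMapRight R (M : Type v) f)

/-- A left `R`-module `M` is *Gorenstein flat* if there is an exact complex of flat
modules `⋯ → F₁ → F₀ → F₋₁ → ⋯` which stays exact after applying `I ⊗[R] -` for every
injective right `R`-module `I`, with `M ≅ ker (F₀ → F₋₁)`. -/
def IsGorensteinFlat (M : ModuleCat.{v} R) : Prop :=
  ∃ (F : ℤ → ModuleCat.{v} R) (d : ∀ i : ℤ, F (i + 1) →ₗ[R] F i),
    (∀ i, IsFlatMod R (F i)) ∧
    (∀ i, Function.Exact (d (i + 1)) (d i)) ∧
    (∀ I : ModuleCat.{v} Rᵐᵒᵖ, Module.Injective Rᵐᵒᵖ I →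
      ∀ i : ℤ, Function.Exact
        (rtMap R (I : Type v) (d (i + 1))) (rtMap R (I : Type v) (d i))) ∧
    Nonempty (M ≃ₗ[R] LinearMap.ker (d (-1)))

/-- A projective resolution `⋯ → P₁ → P₀ → M → 0` of a left `R`-module `M`. -/
structure ProjRes (M : ModuleCat.{v} R) where
  P : ℕ → ModuleCat.{v} R
  d : ∀ i : ℕ, P (i + 1) →ₗ[R] P i
  π : P 0 →ₗ[R] M
  projective : ∀ i, Module.Projective R (P i)
  surj : Function.Surjective π
  exact0 : Function.Exact (d 0) π
  exact : ∀ i, Function.Exact (d (i + 1)) (d i)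

/-- `ExtVanish R X Y m` says that `Ext^{m+1}_R(X, Y) = 0`, expressed by the exactness
of `Hom(P_m, Y) → Hom(P_{m+1}, Y) → Hom(P_{m+2}, Y)` for every projective resolution
`P` of `X`. -/
def ExtVanish (X Y : ModuleCat.{v} R) (m : ℕ) : Prop :=
  ∀ res : ProjRes R X,
    Function.Exact
      (fun f : res.P m →ₗ[R] Y => f.comp (res.d m))
      (fun f : res.P (m + 1) →ₗ[R] Y => f.comp (res.d (m + 1)))

/-- `Ext¹_R(X, Y) = 0`. -/
def Ext1Zero (X Y : ModuleCat.{v} R) : Prop := ExtVanish R X Y 0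

/-- `Y` lies in the right orthogonal class `GP^⊥` of the Gorenstein projective
modules: `Ext¹(G, Y) = 0` for every Gorenstein projective `G`. -/
def InGPOrth (Y : ModuleCat.{v} R) : Prop :=
  ∀ G : ModuleCat.{v} R, IsGorensteinProjective R G → Ext1Zero R G Y

/-- The Gorenstein projective dimension of `M` is at most `n`: there is an exact
sequence `0 → G_n → ⋯ → G_0 → M → 0` with all `G_i` Gorenstein projective (encoded by
an `ℕ`-indexed resolution vanishing in degrees `> n`). -/
def GorProjDimLE (M : ModuleCat.{v} R) (n : ℕ) : Prop :=
  ∃ (G : ℕ → ModuleCat.{v} R) (d : ∀ i : ℕ, G (i + 1) →ₗ[R] G i) (π : G 0 →ₗ[R] M),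
    (∀ i, IsGorensteinProjective R (G i)) ∧
    Function.Surjective π ∧
    Function.Exact (d 0) π ∧
    (∀ i, Function.Exact (d (i + 1)) (d i)) ∧
    (∀ i, n < i → Subsingleton (G i : Type v))

/-- The projective dimension of `M` is at most `n`: there is an exact sequence
`0 → P_n → ⋯ → P_0 → M → 0` with all `P_i` projective. -/
def ProjDimLE (M : ModuleCat.{v} R) (n : ℕ) : Prop :=
  ∃ (P : ℕ → ModuleCat.{v} R) (d : ∀ i : ℕ, P (i + 1) →ₗ[R] P i) (π : P 0 →ₗ[R] M),
    (∀ i, Module.Projective R (P i)) ∧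
    Function.Surjective π ∧
    Function.Exact (d 0) π ∧
    (∀ i, Function.Exact (d (i + 1)) (d i)) ∧
    (∀ i, n < i → Subsingleton (P i : Type v))

/-- A left `R`-module `C` is *cotorsion* if `Ext¹(K, C) = 0` for every flat `K`. -/
def IsCotorsion (C : ModuleCat.{v} R) : Prop :=
  ∀ K : ModuleCat.{v} R, IsFlatMod R K → Ext1Zero R K C

/-- The ring `R` is *left GF-closed* if the class of Gorenstein flat left `R`-modules
is closed under extensions. -/
def GFClosed : Prop :=
  ∀ (A B C : ModuleCat.{v} R) (f : A →ₗ[R] B) (g : B →ₗ[R] C),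
    Function.Injective f → Function.Surjective g → Function.Exact f g →
    IsGorensteinFlat R A → IsGorensteinFlat R C → IsGorensteinFlat R B

/-- The ring `R` is *right coherent* if every direct product of flat left `R`-modules
is flat. -/
def RightCoherent : Prop :=
  ∀ (ι : Type v) (M : ι → ModuleCat.{v} R), (∀ i, IsFlatMod R (M i)) →
    IsFlatMod R (ModuleCat.of R (∀ i, (M i : Type v)))

/-- The ring `R` is *left `n`-perfect* if every flat left `R`-module has projective
dimension at most `n`. -/
def LeftNPerfect (n : ℕ) : Prop :=
  ∀ F : ModuleCat.{v} R, IsFlatMod R F → ProjDimLE R F n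

/-- The ring `R` is *left perfect* if every flat left `R`-module is projective. -/
def LeftPerfect : Prop :=
  ∀ F : ModuleCat.{v} R, IsFlatMod R F → Module.Projective R F

end Defs

end GorensteinPrecover

end

namespace GorensteinPrecover

section ProdModule

variable (R₁ : Type u) (R₂ : Type u) [Ring R₁] [Ring R₂]
variable (M₁ : Type v) (M₂ : Type v) [AddCommGroup M₁] [Module R₁ M₁]
  [AddCommGroup M₂] [Module R₂ M₂]

/-- The componentwise scalar action of a product ring `R₁ × R₂` on `M₁ × M₂`. -/
instance prodRingSMul : SMul (R₁ × R₂) (M₁ × M₂) :=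
  ⟨fun r m => (r.1 • m.1, r.2 • m.2)⟩

@[simp] lemma prodRing_smul_def (r : R₁ × R₂) (m : M₁ × M₂) :
    r • m = (r.1 • m.1, r.2 • m.2) := rfl

/-- The canonical left module structure of the product ring `R₁ × R₂` on `M₁ × M₂`,
for `M₁` a left `R₁`-module and `M₂` a left `R₂`-module. -/
instance prodRingModule : Module (R₁ × R₂) (M₁ × M₂) where
  one_smul m := by simp
  mul_smul r s m := by simp [mul_smul]
  smul_zero r := by simp
  smul_add r m m' := by simp [smul_add]
  add_smul r s m := by simp [add_smul]
  zero_smul m := by simp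

end ProdModule

/-- `S` is realised as a central corner of `Γ`. -/
structure Corner (Γ S : Type u) [Ring Γ] [Ring S] where
  π : Γ →+* S
  ι : S →+ Γ
  ι_mul : ∀ r s, ι (r * s) = ι r * ι s
  π_ι : ∀ s, π (ι s) = s
  ι_π : ∀ g, ι (π g) = ι 1 * g
  ι_π' : ∀ g, ι (π g) = g * ι 1

namespace Corner

variable {Γ S : Type u} [Ring Γ] [Ring S] (c : Corner Γ S)

/-- The corner submodule `eN`. -/
def E (N : Type v) [AddCommGroup N] [Module Γ N] : AddSubgroup N where
  carrier := {x | c.ι 1 • x = x}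
  zero_mem' := by simp
  add_mem' := by
    intro a b ha hb
    simp only [Set.mem_setOf_eq] at ha hb ⊢
    rw [smul_add, ha, hb]
  neg_mem' := by
    intro a ha
    simp only [Set.mem_setOf_eq] at ha ⊢
    rw [smul_neg, ha]

variable {N : Type v} [AddCommGroup N] [Module Γ N]
variable {N' : Type v} [AddCommGroup N'] [Module Γ N']

lemma one_smul_E {N : Type*} [AddCommGroup N] [Module Γ N] (x : c.E N) :
    c.ι 1 • (x : N) = (x : N) := x.2

lemma smul_mem_E {N : Type*} [AddCommGroup N] [Module Γ N] (r : S) (x : N) :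
    c.ι r • x ∈ c.E N := by
  change c.ι 1 • c.ι r • x = c.ι r • x
  rw [← mul_smul, ← c.ι_mul, one_mul]

instance instModE {N : Type*} [AddCommGroup N] [Module Γ N] : Module S (c.E N) where
  smul r x := ⟨c.ι r • (x : N), c.smul_mem_E r (x : N)⟩
  one_smul x := Subtype.ext x.2
  mul_smul r s x := Subtype.ext (by
    change c.ι (r * s) • (x : N) = c.ι r • c.ι s • (x : N)
    rw [c.ι_mul, mul_smul])
  smul_zero r := Subtype.ext (smul_zero (A := N) (c.ι r))
  smul_add r x y := Subtype.ext (smul_add (c.ι r) (x : N) (y : N))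
  add_smul r s x := Subtype.ext (by
    change c.ι (r + s) • (x : N) = c.ι r • (x : N) + c.ι s • (x : N)
    rw [map_add, add_smul])
  zero_smul x := Subtype.ext (by
    change c.ι 0 • (x : N) = 0
    rw [map_zero, zero_smul])

lemma coe_smul_E {N : Type*} [AddCommGroup N] [Module Γ N] (r : S) (x : c.E N) :
    ((r • x : c.E N) : N) = c.ι r • (x : N) := rfl

lemma coe_π_smul_E {N : Type*} [AddCommGroup N] [Module Γ N] (g : Γ) (x : c.E N) :
    ((c.π g • x : c.E N) : N) = g • (x : N) := by
  rw [coe_smul_E, c.ι_π', mul_smul, c.one_smul_E]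

/-- The projection `N → eN`. -/
def pr {N : Type*} [AddCommGroup N] [Module Γ N] (x : N) : c.E N :=
  ⟨c.ι 1 • x, c.smul_mem_E 1 x⟩

lemma pr_add {N : Type*} [AddCommGroup N] [Module Γ N] (x y : N) :
    c.pr (x + y) = c.pr x + c.pr y := Subtype.ext (smul_add _ _ _)

lemma pr_smul {N : Type*} [AddCommGroup N] [Module Γ N] (g : Γ) (x : N) :
    c.pr (g • x) = c.π g • c.pr x := Subtype.ext (by
  rw [coe_π_smul_E]
  change c.ι 1 • g • x = g • c.ι 1 • x
  rw [← mul_smul, ← mul_smul, ← c.ι_π, ← c.ι_π'])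

lemma pr_coe {N : Type*} [AddCommGroup N] [Module Γ N] (x : c.E N) :
    c.pr (x : N) = x := Subtype.ext x.2

/-- Functoriality of the corner. -/
def map {N N' : Type*} [AddCommGroup N] [Module Γ N] [AddCommGroup N'] [Module Γ N']
    (f : N →ₗ[Γ] N') : c.E N →ₗ[S] c.E N' where
  toFun x := ⟨f x, by
    change c.ι 1 • f x = f x
    rw [← map_smul, c.one_smul_E]⟩
  map_add' x y := Subtype.ext (by simp)
  map_smul' r x := Subtype.ext (by simp [coe_smul_E])

lemma coe_map {N N' : Type*} [AddCommGroup N] [Module Γ N] [AddCommGroup N'] [Module Γ N']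
    (f : N →ₗ[Γ] N') (x : c.E N) : (c.map f x : N') = f x := rfl

lemma map_pr {N N' : Type*} [AddCommGroup N] [Module Γ N] [AddCommGroup N'] [Module Γ N']
    (f : N →ₗ[Γ] N') (x : N) : c.map f (c.pr x) = c.pr (f x) :=
  Subtype.ext (map_smul f _ _)

lemma projective_E {N : Type*} [AddCommGroup N] [Module Γ N] (hN : Module.Projective Γ N) :
    Module.Projective S (c.E N) := by
  refine Module.Projective.of_lifting_property'' (fun f hf => ?_)
  letI : Module Γ (c.E N →₀ S) := Module.compHom _ c.π
  letI : Module Γ (c.E N) := Module.compHom _ c.π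
  let f' : (c.E N →₀ S) →ₗ[Γ] c.E N :=
    { toFun := f, map_add' := f.map_add, map_smul' := fun g x => f.map_smul (c.π g) x }
  let p : N →ₗ[Γ] c.E N :=
    { toFun := c.pr, map_add' := c.pr_add, map_smul' := c.pr_smul }
  obtain ⟨h, hh⟩ := Module.projective_lifting_property f' p hf
  refine ⟨{ toFun := fun x => h x, map_add' := fun x y => by simp, map_smul' := fun r x => ?_ }, ?_⟩
  · rw [coe_smul_E, map_smul]
    change c.π (c.ι r) • h x = r • h x
    rw [c.π_ι]
  · ext1 x
    exact (LinearMap.congr_fun hh (x : N)).trans (c.pr_coe x)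

lemma projective_compHom {Q : Type*} [AddCommGroup Q] [Module S Q]
    (hQ : Module.Projective S Q) :
    letI : Module Γ Q := Module.compHom Q c.π
    Module.Projective Γ Q := by
  letI : Module Γ Q := Module.compHom Q c.π
  have hs : ∀ (g : Γ) (q : Q), g • q = c.π g • q := fun _ _ => rfl
  refine Module.Projective.of_lifting_property'' (fun f hf => ?_)
  let f' : c.E (Q →₀ Γ) →ₗ[S] Q :=
    { toFun := fun x => f x
      map_add' := fun x y => by simp
      map_smul' := fun r x => by rw [coe_smul_E, map_smul, hs, c.π_ι]; rfl }
  have hf' : Function.Surjective f' := by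
    intro q
    obtain ⟨x, rfl⟩ := hf q
    refine ⟨c.pr x, ?_⟩
    change f (c.ι 1 • x) = f x
    rw [map_smul, hs, c.π_ι, one_smul]
  obtain ⟨h, hh⟩ := Module.projective_lifting_property f' LinearMap.id hf'
  refine ⟨{ toFun := fun x => h x, map_add' := fun x y => by simp, map_smul' := fun r x => ?_ }, ?_⟩
  · rw [hs, map_smul, coe_π_smul_E]; rfl
  · ext1 x
    exact LinearMap.congr_fun hh x

lemma gp_E (N : ModuleCat.{v} Γ) (M : ModuleCat.{v} S) (e : M ≃ₗ[S] c.E N)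
    (h : IsGorensteinProjective Γ N) : IsGorensteinProjective S M := by
  obtain ⟨P, d, hP, hd, hQ, ⟨φ⟩⟩ := h
  refine ⟨fun i => ModuleCat.of S (c.E (P i)), fun i => c.map (d i),
    fun i => c.projective_E (hP i), fun i y => ⟨fun hy => ?_, ?_⟩, fun Q hQp i f => ⟨fun hf => ?_, ?_⟩, ?_⟩
  · obtain ⟨x, hx⟩ := (hd i (y : P (i + 1))).1 (congrArg Subtype.val hy)
    exact ⟨c.pr x, by rw [map_pr, hx]; exact c.pr_coe y⟩
  · rintro ⟨x, rfl⟩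
    exact Subtype.ext ((hd i _).2 ⟨(x : P (i + 1 + 1)), rfl⟩)
  · letI : Module Γ Q := Module.compHom Q c.π
    have hs : ∀ (g : Γ) (q : Q), g • q = c.π g • q := fun _ _ => rfl
    let F : P (i + 1) →ₗ[Γ] Q :=
      { toFun := fun x => f (c.pr x)
        map_add' := fun x y => by rw [pr_add]; exact f.map_add _ _
        map_smul' := fun g x => by rw [pr_smul]; exact f.map_smul _ _ }
    obtain ⟨G, hG⟩ := (hQ (ModuleCat.of Γ Q) (c.projective_compHom hQp) i F).1 (by
      ext1 x
      change f (c.pr (d (i + 1) x)) = 0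
      rw [← map_pr]
      exact LinearMap.congr_fun hf (c.pr x))
    refine ⟨{ toFun := fun x => G (x : P i), map_add' := fun x y => G.map_add _ _,
              map_smul' := fun r x => ?_ }, ?_⟩
    · refine (G.map_smul (c.ι r) (x : P i)).trans ?_
      change c.π (c.ι r) • G _ = _
      rw [c.π_ι]; rfl
    · ext1 y
      refine (LinearMap.congr_fun hG (y : P (i + 1))).trans ?_
      exact congrArg f (c.pr_coe y)
  · rintro ⟨g, rfl⟩
    ext1 x
    change g (c.map (d i) (c.map (d (i + 1)) x)) = 0
    have : c.map (d i) (c.map (d (i + 1)) x) = 0 :=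
      Subtype.ext ((hd i _).2 ⟨(x : P (i + 1 + 1)), rfl⟩)
    rw [this]
    exact map_zero g
  · let K := LinearMap.ker (d (-1))
    let ψ : c.E N →ₗ[S] LinearMap.ker (c.map (d (-1))) :=
      LinearMap.codRestrict _ (c.map (K.subtype.comp φ.toLinearMap))
        (fun x => Subtype.ext (φ (x : N)).2)
    have hψ : Function.Bijective ψ := by
      constructor
      · intro x y hxy
        have h1 : ((φ (x : N) : K) : P (-1 + 1)) = φ (y : N) :=
          congrArg (fun z : LinearMap.ker (c.map (d (-1))) => ((z.1 : c.E (P (-1 + 1))) : P (-1 + 1))) hxy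
        exact Subtype.ext (φ.injective (Subtype.ext h1))
      · intro y
        have hy : d (-1) ((y : c.E (P (-1 + 1))) : P (-1 + 1)) = 0 :=
          congrArg Subtype.val y.2
        let k : K := ⟨_, hy⟩
        have hk : c.ι 1 • k = k := Subtype.ext (c.one_smul_E y.1)
        refine ⟨⟨φ.symm k, ?_⟩, ?_⟩
        · change c.ι 1 • φ.symm k = φ.symm k
          rw [← map_smul, hk]
        · apply Subtype.ext
          apply Subtype.ext
          change ((φ (φ.symm k) : K) : P (-1 + 1)) = _
          rw [φ.apply_symm_apply]
    exact ⟨e.trans (LinearEquiv.ofBijective ψ hψ)⟩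

end Corner

section ProdCorner

variable (R₁ R₂ : Type u) [Ring R₁] [Ring R₂]

/-- First factor of the product ring as a corner. -/
def corner₁ : Corner (R₁ × R₂) R₁ where
  π := RingHom.fst R₁ R₂
  ι := AddMonoidHom.inl R₁ R₂
  ι_mul r s := by simp
  π_ι s := by simp
  ι_π g := by ext <;> simp
  ι_π' g := by ext <;> simp

/-- Second factor of the product ring as a corner. -/
def corner₂ : Corner (R₁ × R₂) R₂ where
  π := RingHom.snd R₁ R₂
  ι := AddMonoidHom.inr R₁ R₂
  ι_mul r s := by simp
  π_ι s := by simp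
  ι_π g := by ext <;> simp
  ι_π' g := by ext <;> simp

variable {R₁ R₂}

/-- Assemble a `Γ`-linear map out of a product from its two corner components. -/
def glue {A₁ A₂ : Type v} [AddCommGroup A₁] [Module R₁ A₁] [AddCommGroup A₂] [Module R₂ A₂]
    {N : Type*} [AddCommGroup N] [Module (R₁ × R₂) N]
    (f₁ : A₁ →ₗ[R₁] (corner₁ R₁ R₂).E N) (f₂ : A₂ →ₗ[R₂] (corner₂ R₁ R₂).E N) :
    A₁ × A₂ →ₗ[R₁ × R₂] N where
  toFun x := (f₁ x.1 : N) + (f₂ x.2 : N)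
  map_add' x y := by
    simp only [Prod.fst_add, Prod.snd_add, map_add, AddSubgroup.coe_add]
    abel
  map_smul' r x := by
    have h1 : f₁ (r • x).1 = (corner₁ R₁ R₂).π r • f₁ x.1 := f₁.map_smul r.1 x.1
    have h2 : f₂ (r • x).2 = (corner₂ R₁ R₂).π r • f₂ x.2 := f₂.map_smul r.2 x.2
    rw [h1, h2, Corner.coe_π_smul_E, Corner.coe_π_smul_E, ← smul_add]
    rfl

/-- First component of a linear map out of a product. -/
def comp₁ {A₁ A₂ : Type v} [AddCommGroup A₁] [Module R₁ A₁] [AddCommGroup A₂] [Module R₂ A₂]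
    {N : Type*} [AddCommGroup N] [Module (R₁ × R₂) N]
    (f : A₁ × A₂ →ₗ[R₁ × R₂] N) : A₁ →ₗ[R₁] (corner₁ R₁ R₂).E N where
  toFun x := ⟨f (x, 0), by
    change ((1, 0) : R₁ × R₂) • f (x, 0) = f (x, 0)
    rw [← map_smul]
    simp⟩
  map_add' x y := Subtype.ext (by
    change f (x + y, 0) = f (x, 0) + f (y, 0)
    rw [← map_add]; simp)
  map_smul' r x := Subtype.ext (by
    change f (r • x, 0) = ((r, 0) : R₁ × R₂) • f (x, 0)
    rw [← map_smul]; simp)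

/-- Second component of a linear map out of a product. -/
def comp₂ {A₁ A₂ : Type v} [AddCommGroup A₁] [Module R₁ A₁] [AddCommGroup A₂] [Module R₂ A₂]
    {N : Type*} [AddCommGroup N] [Module (R₁ × R₂) N]
    (f : A₁ × A₂ →ₗ[R₁ × R₂] N) : A₂ →ₗ[R₂] (corner₂ R₁ R₂).E N where
  toFun x := ⟨f (0, x), by
    change ((0, 1) : R₁ × R₂) • f (0, x) = f (0, x)
    rw [← map_smul]
    simp⟩
  map_add' x y := Subtype.ext (by
    change f (0, x + y) = f (0, x) + f (0, y)
    rw [← map_add]; simp)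
  map_smul' r x := Subtype.ext (by
    change f (0, r • x) = ((0, r) : R₁ × R₂) • f (0, x)
    rw [← map_smul]; simp)

/-- Product of linear maps over the two factors. -/
def pmap {A₁ A₂ B₁ B₂ : Type v} [AddCommGroup A₁] [Module R₁ A₁] [AddCommGroup A₂] [Module R₂ A₂]
    [AddCommGroup B₁] [Module R₁ B₁] [AddCommGroup B₂] [Module R₂ B₂]
    (f₁ : A₁ →ₗ[R₁] B₁) (f₂ : A₂ →ₗ[R₂] B₂) : A₁ × A₂ →ₗ[R₁ × R₂] B₁ × B₂ where
  toFun x := (f₁ x.1, f₂ x.2)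
  map_add' x y := by simp
  map_smul' r x := by simp

lemma projective_prod' {A₁ A₂ : Type v} [AddCommGroup A₁] [Module R₁ A₁]
    [AddCommGroup A₂] [Module R₂ A₂]
    (h₁ : Module.Projective R₁ A₁) (h₂ : Module.Projective R₂ A₂) :
    Module.Projective (R₁ × R₂) (A₁ × A₂) := by
  refine Module.Projective.of_lifting_property'' (fun f hf => ?_)
  let F := (A₁ × A₂) →₀ (R₁ × R₂)
  let f₁ : (corner₁ R₁ R₂).E F →ₗ[R₁] A₁ :=
    { toFun := fun x => (f x).1
      map_add' := fun x y => by simp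
      map_smul' := fun r x => by rw [Corner.coe_smul_E, map_smul]; rfl }
  let f₂ : (corner₂ R₁ R₂).E F →ₗ[R₂] A₂ :=
    { toFun := fun x => (f x).2
      map_add' := fun x y => by simp
      map_smul' := fun r x => by rw [Corner.coe_smul_E, map_smul]; rfl }
  have s₁ : Function.Surjective f₁ := by
    intro a
    obtain ⟨x, hx⟩ := hf (a, 0)
    refine ⟨(corner₁ R₁ R₂).pr x, ?_⟩
    change (f (((1, 0) : R₁ × R₂) • x)).1 = a
    rw [map_smul, hx]; simp
  have s₂ : Function.Surjective f₂ := by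
    intro a
    obtain ⟨x, hx⟩ := hf (0, a)
    refine ⟨(corner₂ R₁ R₂).pr x, ?_⟩
    change (f (((0, 1) : R₁ × R₂) • x)).2 = a
    rw [map_smul, hx]; simp
  obtain ⟨g₁, hg₁⟩ := Module.projective_lifting_property f₁ LinearMap.id s₁
  obtain ⟨g₂, hg₂⟩ := Module.projective_lifting_property f₂ LinearMap.id s₂
  refine ⟨glue g₁ g₂, ?_⟩
  ext1 x
  have e₁ : (f (g₁ x.1)).1 = x.1 := LinearMap.congr_fun hg₁ x.1
  have e₂ : (f (g₂ x.2)).2 = x.2 := LinearMap.congr_fun hg₂ x.2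
  have z₁ : (f (g₁ x.1)).2 = 0 := by
    rw [← (corner₁ R₁ R₂).one_smul_E (g₁ x.1), map_smul]
    exact zero_smul _ _
  have z₂ : (f (g₂ x.2)).1 = 0 := by
    rw [← (corner₂ R₁ R₂).one_smul_E (g₂ x.2), map_smul]
    exact zero_smul _ _
  change f ((g₁ x.1 : F) + (g₂ x.2 : F)) = x
  rw [map_add]
  ext <;> simp [e₁, e₂, z₁, z₂]

lemma gp_prod (M₁ : ModuleCat.{v} R₁) (M₂ : ModuleCat.{v} R₂)
    (h₁ : IsGorensteinProjective R₁ M₁) (h₂ : IsGorensteinProjective R₂ M₂) :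
    IsGorensteinProjective (R₁ × R₂)
        (ModuleCat.of (R₁ × R₂) (Prod (M₁ : Type v) (M₂ : Type v))) := by
  obtain ⟨P, d, hP, hd, hQ, ⟨φ⟩⟩ := h₁
  obtain ⟨P', d', hP', hd', hQ', ⟨φ'⟩⟩ := h₂
  have hdd : ∀ i x, d i (d (i + 1) x) = 0 := fun i x => (hd i _).2 ⟨x, rfl⟩
  have hdd' : ∀ i x, d' i (d' (i + 1) x) = 0 := fun i x => (hd' i _).2 ⟨x, rfl⟩
  refine ⟨fun i => ModuleCat.of (R₁ × R₂) (P i × P' i), fun i => pmap (d i) (d' i),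
    fun i => projective_prod' (hP i) (hP' i), fun i y => ⟨fun hy => ?_, ?_⟩,
    fun Q hQp i f => ⟨fun hf => ?_, ?_⟩, ?_⟩
  · obtain ⟨x, hx⟩ := (hd i y.1).1 (congrArg Prod.fst hy)
    obtain ⟨x', hx'⟩ := (hd' i y.2).1 (congrArg Prod.snd hy)
    exact ⟨(x, x'), Prod.ext hx hx'⟩
  · rintro ⟨x, rfl⟩
    exact Prod.ext (hdd i x.1) (hdd' i x.2)
  · obtain ⟨g, hg⟩ := (hQ (ModuleCat.of R₁ ((corner₁ R₁ R₂).E Q))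
      ((corner₁ R₁ R₂).projective_E hQp) i (comp₁ f)).1 (by
        ext1 x
        apply Subtype.ext
        have := LinearMap.congr_fun hf (x, 0)
        change f (d (i + 1) x, d' (i + 1) 0) = 0 at this
        rw [map_zero] at this
        exact this)
    obtain ⟨g', hg'⟩ := (hQ' (ModuleCat.of R₂ ((corner₂ R₁ R₂).E Q))
      ((corner₂ R₁ R₂).projective_E hQp) i (comp₂ f)).1 (by
        ext1 x
        apply Subtype.ext
        have := LinearMap.congr_fun hf (0, x)
        change f (d (i + 1) 0, d' (i + 1) x) = 0 at this
        rw [map_zero] at this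
        exact this)
    refine ⟨glue g g', ?_⟩
    refine LinearMap.ext fun x => ?_
    have e₁ : ((g (d i x.1) : (corner₁ R₁ R₂).E Q) : Q) = f (x.1, 0) :=
      congrArg Subtype.val (LinearMap.congr_fun hg x.1)
    have e₂ : ((g' (d' i x.2) : (corner₂ R₁ R₂).E Q) : Q) = f (0, x.2) :=
      congrArg Subtype.val (LinearMap.congr_fun hg' x.2)
    change ((g (d i x.1) : (corner₁ R₁ R₂).E Q) : Q) +
      ((g' (d' i x.2) : (corner₂ R₁ R₂).E Q) : Q) = f x
    rw [e₁, e₂]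
    refine (f.map_add (x.1, 0) (0, x.2)).symm.trans (congrArg f ?_)
    exact Prod.ext (add_zero x.1) (zero_add x.2)
  · rintro ⟨g, rfl⟩
    refine LinearMap.ext fun x => ?_
    change g (d i (d (i + 1) x.1), d' i (d' (i + 1) x.2)) = 0
    rw [hdd, hdd']
    exact map_zero g
  · let ψ := LinearMap.codRestrict (LinearMap.ker (pmap (d (-1)) (d' (-1))))
        (pmap ((LinearMap.ker (d (-1))).subtype.comp φ.toLinearMap)
          ((LinearMap.ker (d' (-1))).subtype.comp φ'.toLinearMap))
        (fun x : M₁ × M₂ => Prod.ext (φ x.1).2 (φ' x.2).2)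
    refine ⟨LinearEquiv.ofBijective ψ ⟨fun x y hxy => ?_, fun y => ?_⟩⟩
    · have h := congrArg Subtype.val hxy
      exact Prod.ext (φ.injective (Subtype.ext (congrArg Prod.fst h)))
        (φ'.injective (Subtype.ext (congrArg Prod.snd h)))
    · have h₁ : d (-1) y.1.1 = 0 := congrArg Prod.fst y.2
      have h₂ : d' (-1) y.1.2 = 0 := congrArg Prod.snd y.2
      refine ⟨(φ.symm ⟨_, h₁⟩, φ'.symm ⟨_, h₂⟩), Subtype.ext (Prod.ext ?_ ?_)⟩
      · exact congrArg Subtype.val (φ.apply_symm_apply ⟨_, h₁⟩)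
      · exact congrArg Subtype.val (φ'.apply_symm_apply ⟨_, h₂⟩)

/-- The first corner of a product. -/
noncomputable def equiv₁ (A₁ A₂ : Type v) [AddCommGroup A₁] [Module R₁ A₁] [AddCommGroup A₂] [Module R₂ A₂] :
    A₁ ≃ₗ[R₁] (corner₁ R₁ R₂).E (A₁ × A₂) :=
  LinearEquiv.ofBijective (comp₁ (LinearMap.id : (A₁ × A₂) →ₗ[R₁ × R₂] A₁ × A₂)) ⟨fun _ _ h =>
    congrArg (fun z : (corner₁ R₁ R₂).E (A₁ × A₂) => (z : A₁ × A₂).1) h, fun y => ⟨y.1.1, Subtype.ext (Prod.ext rfl (by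
      have h : (0 : R₂) • y.1.2 = y.1.2 := congrArg Prod.snd y.2
      rw [zero_smul] at h
      exact h))⟩⟩

/-- The second corner of a product. -/
noncomputable def equiv₂ (A₁ A₂ : Type v) [AddCommGroup A₁] [Module R₁ A₁] [AddCommGroup A₂] [Module R₂ A₂] :
    A₂ ≃ₗ[R₂] (corner₂ R₁ R₂).E (A₁ × A₂) :=
  LinearEquiv.ofBijective (comp₂ (LinearMap.id : (A₁ × A₂) →ₗ[R₁ × R₂] A₁ × A₂)) ⟨fun _ _ h =>
    congrArg (fun z : (corner₂ R₁ R₂).E (A₁ × A₂) => (z : A₁ × A₂).2) h, fun y => ⟨y.1.2, Subtype.ext (Prod.ext (by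
      have h : (0 : R₁) • y.1.1 = y.1.1 := congrArg Prod.fst y.2
      rw [zero_smul] at h
      exact h) rfl)⟩⟩

end ProdCorner

/-- For rings `R₁`, `R₂` and `Γ = R₁ × R₂`, a left `Γ`-module
`M = M₁ ⊕ M₂` (with `M₁` a left `R₁`-module and `M₂` a left `R₂`-module) is
Gorenstein projective over `Γ` if and only if `M₁` is Gorenstein projective over
`R₁` and `M₂` is Gorenstein projective over `R₂`. -/
theorem gorenstein_projective_prod_iff
    (R₁ R₂ : Type u) [Ring R₁] [Ring R₂]
    (M₁ : ModuleCat.{v} R₁) (M₂ : ModuleCat.{v} R₂) :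
    IsGorensteinProjective (R₁ × R₂)
        (ModuleCat.of (R₁ × R₂) (Prod (M₁ : Type v) (M₂ : Type v))) ↔
      IsGorensteinProjective R₁ M₁ ∧ IsGorensteinProjective R₂ M₂ := by
  exact ⟨fun h => ⟨(corner₁ R₁ R₂).gp_E _ M₁ (equiv₁ M₁ M₂) h,
      (corner₂ R₁ R₂).gp_E _ M₂ (equiv₂ M₁ M₂) h⟩, fun h => gp_prod M₁ M₂ h.1 h.2⟩

end GorensteinPrecover
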